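/- Let H be a finite-dimensional Hopf algebra over ℂ, let h ∈ H be a normalized two-sided integral, and let V be a finite-dimensional ℂ-vector space. Let M be the linear endomorphism of H ⊗ H ⊗ H determined by M(x⊗y⊗z) = h₁x ⊗ h₂y ⊗ h₃z, and let W = {u ∈ H ⊗ H ⊗ H ⊗ V : (M ⊗ id_V)(u) = u}. Then W is contained in the image of ρ ⊗ id_V, where ρ : H ⊗ H → H ⊗ H ⊗ H is the linear map ρ(a⊗b) = h₁ ⊗ h₂a ⊗ h₃b; in particular dim_ℂ W ≤ (dim_ℂ H)²·dim_ℂ V. -/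

import Mathlib

open TensorProduct

variable (H : Type*) [Ring H] [HopfAlgebra ℂ H]

/-- The threefold iterated comultiplication `x ↦ x₁ ⊗ x₂ ⊗ x₃`. -/
noncomputable def comul₃ : H →ₗ[ℂ] H ⊗[ℂ] (H ⊗[ℂ] H) :=
  LinearMap.lTensor H (Coalgebra.comul (R := ℂ)) ∘ₗ Coalgebra.comul (R := ℂ)

section

open Coalgebra

variable {R A : Type*} [CommRing R] [Ring A] [HopfAlgebra R A]

/-- `x₁ ⊗ x₂ S(x₃) = x ⊗ 1`. -/
theorem lTensor_mul_antipode_comul_rTensor_comul (x : A) :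
    LinearMap.lTensor A (LinearMap.mul' R A ∘ₗ (HopfAlgebra.antipode R).lTensor A)
      (TensorProduct.assoc R A A A (comul.rTensor A (comul x))) = x ⊗ₜ[R] 1 := by
  rw [coassoc_apply, ← LinearMap.comp_apply, ← LinearMap.lTensor_comp, LinearMap.comp_assoc,
    HopfAlgebra.mul_antipode_lTensor_comul, LinearMap.lTensor_comp, LinearMap.comp_apply,
    lTensor_counit_comul]
  simp

/-- For a right integral `h`, one has `h₁x ⊗ h₂ = h₁ ⊗ h₂S(x)`. -/
theorem comul_mul_tmul_one_of_integral {h : A}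
    (hh : ∀ x : A, h * x = counit (R := R) x • h) (x : A) :
    comul (R := R) h * (x ⊗ₜ[R] 1) = comul h * (1 ⊗ₜ[R] HopfAlgebra.antipode R x) := by
  have key (t : A ⊗[R] A) :
      comul h * LinearMap.lTensor A (LinearMap.mul' R A ∘ₗ (HopfAlgebra.antipode R).lTensor A)
        (TensorProduct.assoc R A A A (comul.rTensor A t)) =
      comul h * (1 ⊗ₜ[R] HopfAlgebra.antipode R
        (TensorProduct.lid R A (counit.rTensor A t))) := by
    induction t with
    | zero => simp
    | add a b ha hb => simp only [map_add, mul_add, TensorProduct.tmul_add, ha, hb]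
    | tmul a b =>
      have h1 (u : A ⊗[R] A) :
          LinearMap.lTensor A (LinearMap.mul' R A ∘ₗ (HopfAlgebra.antipode R).lTensor A)
            (TensorProduct.assoc R A A A (u ⊗ₜ[R] b)) =
          u * (1 ⊗ₜ[R] HopfAlgebra.antipode R b) := by
        induction u with
        | zero => simp
        | add a c ha hc => simp only [TensorProduct.add_tmul, map_add, add_mul, ha, hc]
        | tmul a c => simp
      rw [LinearMap.rTensor_tmul, h1, ← mul_assoc, ← Bialgebra.comul_mul, hh]
      simp
  simpa only [lTensor_mul_antipode_comul_rTensor_comul, rTensor_counit_comul,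
    TensorProduct.lid_tmul, one_smul] using key (comul x)

end

/-- Every element of a triple tensor product is a finite sum of pure tensors, indexed in `Type`. -/
theorem exists_sum_tmul_tmul {R A : Type*} [CommRing R] [AddCommGroup A] [Module R A]
    (t : A ⊗[R] (A ⊗[R] A)) :
    ∃ (n : ℕ) (a b c : Fin n → A), t = ∑ i, a i ⊗ₜ[R] (b i ⊗ₜ[R] c i) := by
  have single (x y z : A) : ∃ (n : ℕ) (a b c : Fin n → A),
      x ⊗ₜ[R] (y ⊗ₜ[R] z) = ∑ i, a i ⊗ₜ[R] (b i ⊗ₜ[R] c i) :=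
    ⟨1, fun _ => x, fun _ => y, fun _ => z, by simp⟩
  have sum (t u : A ⊗[R] (A ⊗[R] A))
      (ht : ∃ (n : ℕ) (a b c : Fin n → A), t = ∑ i, a i ⊗ₜ[R] (b i ⊗ₜ[R] c i))
      (hu : ∃ (n : ℕ) (a b c : Fin n → A), u = ∑ i, a i ⊗ₜ[R] (b i ⊗ₜ[R] c i)) :
      ∃ (n : ℕ) (a b c : Fin n → A), t + u = ∑ i, a i ⊗ₜ[R] (b i ⊗ₜ[R] c i) := by
    obtain ⟨n, a, b, c, rfl⟩ := ht
    obtain ⟨m, a', b', c', rfl⟩ := hu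
    exact ⟨n + m, Fin.append a a', Fin.append b b', Fin.append c c', by
      simp [Fin.sum_univ_add]⟩
  have zero : ∃ (n : ℕ) (a b c : Fin n → A),
      (0 : A ⊗[R] (A ⊗[R] A)) = ∑ i, a i ⊗ₜ[R] (b i ⊗ₜ[R] c i) :=
    ⟨0, 0, 0, 0, by simp⟩
  induction t with
  | zero => exact zero
  | add t u ht hu => exact sum t u ht hu
  | tmul x v =>
    induction v with
    | zero => simpa using zero
    | add v w hv hw => simpa only [TensorProduct.tmul_add] using sum _ _ hv hw
    | tmul y z => exact single x y z

/-- For a right integral `h`, one has `h₁x ⊗ h₂ ⊗ h₃ = h₁ ⊗ h₂S(x)₁ ⊗ h₃S(x)₂`. -/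
theorem comul₃_mul_tmul_one_of_integral {h : H}
    (hh : ∀ x : H, h * x = Coalgebra.counit (R := ℂ) x • h) (x : H) :
    comul₃ H h * (x ⊗ₜ[ℂ] 1) =
      comul₃ H h * (1 ⊗ₜ[ℂ] Coalgebra.comul (R := ℂ) (HopfAlgebra.antipode ℂ x)) := by
  let φ := Algebra.TensorProduct.map (AlgHom.id ℂ H) (Bialgebra.comulAlgHom ℂ H)
  have hφ : comul₃ H h = φ (Coalgebra.comul h) := rfl
  have := congrArg φ (comul_mul_tmul_one_of_integral hh x)
  rw [map_mul, map_mul, ← hφ] at this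
  simpa [φ] using this

/-- Let `H` be a finite-dimensional Hopf algebra over `ℂ`, `h ∈ H` a normalized two-sided
integral and `V` a finite-dimensional `ℂ`-vector space.  Let `M : H⊗H⊗H → H⊗H⊗H` be determined
by `M(x⊗y⊗z) = h₁x ⊗ h₂y ⊗ h₃z` and let `W` be the fixed-point set of `M ⊗ id_V` in
`H⊗H⊗H⊗V`.  Then `W` is contained in the image of `ρ ⊗ id_V`, where `ρ : H⊗H → H⊗H⊗H` is
`ρ(a⊗b) = h₁ ⊗ h₂a ⊗ h₃b`; in particular `dim_ℂ W ≤ (dim_ℂ H)² · dim_ℂ V`. -/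
theorem fixedPoints_subset_range_rho_tensor_id
    [FiniteDimensional ℂ H]
    (h : H)
    (hh_left : ∀ x : H, x * h = Coalgebra.counit (R := ℂ) x • h)
    (hh_right : ∀ x : H, h * x = Coalgebra.counit (R := ℂ) x • h)
    (hh_one : Coalgebra.counit (R := ℂ) h = 1)
    (V : Type*) [AddCommGroup V] [Module ℂ V] [FiniteDimensional ℂ V]
    (M : (H ⊗[ℂ] (H ⊗[ℂ] H)) →ₗ[ℂ] (H ⊗[ℂ] (H ⊗[ℂ] H)))
    (hM : ∀ (x y z : H) (ι : Type) (s : Finset ι) (h₁ h₂ h₃ : ι → H),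
      comul₃ H h = ∑ i ∈ s, h₁ i ⊗ₜ[ℂ] (h₂ i ⊗ₜ[ℂ] h₃ i) →
      M (x ⊗ₜ[ℂ] (y ⊗ₜ[ℂ] z)) = ∑ i ∈ s,
        (h₁ i * x) ⊗ₜ[ℂ] ((h₂ i * y) ⊗ₜ[ℂ] (h₃ i * z)))
    (ρ : (H ⊗[ℂ] H) →ₗ[ℂ] (H ⊗[ℂ] (H ⊗[ℂ] H)))
    (hρ : ∀ (a b : H) (ι : Type) (s : Finset ι) (h₁ h₂ h₃ : ι → H),
      comul₃ H h = ∑ i ∈ s, h₁ i ⊗ₜ[ℂ] (h₂ i ⊗ₜ[ℂ] h₃ i) →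
      ρ (a ⊗ₜ[ℂ] b) = ∑ i ∈ s, h₁ i ⊗ₜ[ℂ] ((h₂ i * a) ⊗ₜ[ℂ] (h₃ i * b))) :
    {w : (H ⊗[ℂ] (H ⊗[ℂ] H)) ⊗[ℂ] V | LinearMap.rTensor V M w = w} ⊆
      Set.range (LinearMap.rTensor V ρ) ∧
    Set.finrank ℂ {w : (H ⊗[ℂ] (H ⊗[ℂ] H)) ⊗[ℂ] V | LinearMap.rTensor V M w = w} ≤
      Module.finrank ℂ H ^ 2 * Module.finrank ℂ V := by
  obtain ⟨n, a, b, c, hrep⟩ := exists_sum_tmul_tmul (comul₃ H h)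
  have hM' (x y z : H) :
      M (x ⊗ₜ[ℂ] (y ⊗ₜ[ℂ] z)) = comul₃ H h * (x ⊗ₜ[ℂ] (y ⊗ₜ[ℂ] z)) := by
    rw [hM x y z _ _ a b c hrep, hrep, Finset.sum_mul]
    simp
  have hρ' (u : H ⊗[ℂ] H) : ρ u = comul₃ H h * (1 ⊗ₜ[ℂ] u) := by
    induction u with
    | zero => simp
    | add u v hu hv => rw [map_add, hu, hv, TensorProduct.tmul_add, mul_add]
    | tmul y z =>
      rw [hρ y z _ _ a b c hrep, hrep, Finset.sum_mul]
      simp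
  have hle : LinearMap.range M ≤ LinearMap.range ρ := by
    rw [LinearMap.range_eq_map, ← TensorProduct.span_tmul_eq_top, Submodule.map_span,
      Submodule.span_le]
    rintro _ ⟨_, ⟨x, v, rfl⟩, rfl⟩
    induction v with
    | zero => simp
    | add v w hv hw =>
      rw [TensorProduct.tmul_add, map_add]
      exact add_mem hv hw
    | tmul y z =>
      refine ⟨Coalgebra.comul (HopfAlgebra.antipode ℂ x) * (y ⊗ₜ[ℂ] z), ?_⟩
      calc ρ (Coalgebra.comul (HopfAlgebra.antipode ℂ x) * (y ⊗ₜ[ℂ] z))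
          = comul₃ H h * (1 ⊗ₜ[ℂ] Coalgebra.comul (R := ℂ) (HopfAlgebra.antipode ℂ x)) *
              (1 ⊗ₜ[ℂ] (y ⊗ₜ[ℂ] z)) := by
            rw [hρ', mul_assoc, Algebra.TensorProduct.tmul_mul_tmul, one_mul]
        _ = comul₃ H h * (x ⊗ₜ[ℂ] 1) * (1 ⊗ₜ[ℂ] (y ⊗ₜ[ℂ] z)) := by
            rw [comul₃_mul_tmul_one_of_integral H hh_right]
        _ = M (x ⊗ₜ[ℂ] (y ⊗ₜ[ℂ] z)) := by
            rw [hM', mul_assoc, Algebra.TensorProduct.tmul_mul_tmul, one_mul, mul_one]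
  have hrange (w : (H ⊗[ℂ] (H ⊗[ℂ] H)) ⊗[ℂ] V) :
      LinearMap.rTensor V M w ∈ LinearMap.range (LinearMap.rTensor V ρ) := by
    induction w with
    | zero => simp
    | add u v hu hv =>
      rw [map_add]
      exact add_mem hu hv
    | tmul t v =>
      obtain ⟨u, hu⟩ := hle ⟨t, rfl⟩
      exact ⟨u ⊗ₜ[ℂ] v, by simp [hu]⟩
  have hsub : {w : (H ⊗[ℂ] (H ⊗[ℂ] H)) ⊗[ℂ] V | LinearMap.rTensor V M w = w} ⊆
      LinearMap.range (LinearMap.rTensor V ρ) := by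
    intro w hw
    have := hrange w
    rwa [hw] at this
  refine ⟨hsub, ?_⟩
  calc Set.finrank ℂ {w : (H ⊗[ℂ] (H ⊗[ℂ] H)) ⊗[ℂ] V | LinearMap.rTensor V M w = w}
      ≤ Module.finrank ℂ (LinearMap.range (LinearMap.rTensor V ρ)) :=
        Submodule.finrank_mono (Submodule.span_le.2 hsub)
    _ ≤ Module.finrank ℂ ((H ⊗[ℂ] H) ⊗[ℂ] V) := LinearMap.finrank_range_le _
    _ = Module.finrank ℂ H ^ 2 * Module.finrank ℂ V := by
        rw [Module.finrank_tensorProduct, Module.finrank_tensorProduct, sq]
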